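/- arXiv:2401.14669 — 2 statements merged into one kernel-verified Lean document; each statement's English description precedes it below -/
import Mathlib

section
/- Let p be a probability measure on the product ∏_{t=0}^n X_t of standard Borel spaces. Then the following are equivalent: (a) the local Markov property: for every 1 ≤ t ≤ n, the coordinate X_t is conditionally independent of the coordinates (X_0, …, X_{t-2}) given the coordinate X_{t-1} under p; (c) p factorizes as a Markov chain, i.e. there exist a probability measure f_0 on X_0 and Markov kernels f_t : X_{t-1} → X_t for 1 ≤ t ≤ n such that p(S_0 × ⋯ × S_n) = ∫_{S_0} ⋯ ∫_{S_n} f_n(dx_n | x_{n-1}) ⋯ f_1(dx_1 | x_0) f_0(dx_0) for all measurable S_t ⊆ X_t. -/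
open MeasureTheory ProbabilityTheory
open scoped ENNReal

namespace MarkovChainStmt

variable {n : ℕ}

/-- The σ-algebra on a product generated by the coordinates in `A`. -/
def coordSigma {X : Fin (n+1) → Type*} [∀ i, MeasurableSpace (X i)]
    (A : Set (Fin (n+1))) : MeasurableSpace (∀ i, X i) :=
  ⨆ i ∈ A, MeasurableSpace.comap (fun ω => ω i) inferInstance

lemma coordSigma_le {X : Fin (n+1) → Type*} [∀ i, MeasurableSpace (X i)]
    (A : Set (Fin (n+1))) : coordSigma (X := X) A ≤ MeasurableSpace.pi := by
  refine iSup_le fun i => iSup_le fun _ => ?_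
  exact (measurable_pi_apply i).comap_le

/-- Conditional independence (in the sense of `ProbabilityTheory.CondIndep`) of the
coordinates in `A` from the coordinates in `B`, given the coordinates in `C`, under `p`. -/
def CondIndepCoords {X : Fin (n+1) → Type*} [∀ i, MeasurableSpace (X i)]
    [∀ i, StandardBorelSpace (X i)]
    (p : Measure (∀ i, X i)) [IsFiniteMeasure p] (C A B : Set (Fin (n+1))) : Prop :=
  CondIndep (coordSigma C) (coordSigma A) (coordSigma B) (coordSigma_le C) p

/-- The backward value function computing the iterated integral
`∫_{S_{t+1}} ⋯ ∫_{S_n} f_n(dx_n|x_{n-1}) ⋯ f_{t+1}(dx_{t+1}|x_t)` as a function of `x_t`. -/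
noncomputable def mcBack {X : Fin (n+1) → Type*} [∀ i, MeasurableSpace (X i)]
    (f : ∀ t : Fin n, Kernel (X t.castSucc) (X t.succ)) (S : ∀ i, Set (X i)) :
    ∀ t : Fin (n+1), X t → ℝ≥0∞ :=
  Fin.reverseInduction (fun _ => 1)
    (fun i ih x => ∫⁻ x' in S i.succ, ih x' ∂ (f i x))

/-- `p` factorizes as a Markov chain: there are an initial distribution `f₀` and Markov
transition kernels `f t` such that for all measurable sets `S i`,
`p (S_0 × ⋯ × S_n) = ∫_{S_0} ⋯ ∫_{S_n} f_n(dx_n|x_{n-1}) ⋯ f_1(dx_1|x_0) f_0(dx_0)`. -/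
def FactorizesAsMarkovChain {X : Fin (n+1) → Type*} [∀ i, MeasurableSpace (X i)]
    (p : Measure (∀ i, X i)) : Prop :=
  ∃ f₀ : Measure (X 0), IsProbabilityMeasure f₀ ∧
    ∃ f : ∀ t : Fin n, Kernel (X t.castSucc) (X t.succ),
      (∀ t, IsMarkovKernel (f t)) ∧
      ∀ S : ∀ i, Set (X i), (∀ i, MeasurableSet (S i)) →
        p (Set.univ.pi S) = ∫⁻ x₀ in S 0, mcBack f S 0 x₀ ∂ f₀


/-- `g` and `f` are conditionally independent given `k` iff some Markov kernel from the values of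
`k` is a conditional distribution of `f` given `(k, g)`. -/
lemma condIndepFun_iff_exists_kernel {Ω α β γ : Type*} {mΩ : MeasurableSpace Ω}
    [StandardBorelSpace Ω] {mα : MeasurableSpace α} {mβ : MeasurableSpace β}
    {mγ : MeasurableSpace γ} [StandardBorelSpace α] [Nonempty α] [StandardBorelSpace β]
    [Nonempty β] {μ : Measure Ω} [IsFiniteMeasure μ] {f : Ω → α} {g : Ω → β} {k : Ω → γ}
    (hf : Measurable f) (hg : Measurable g) (hk : Measurable k) :
    CondIndepFun (MeasurableSpace.comap k inferInstance) hk.comap_le g f μ ↔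
      ∃ κ : Kernel γ α, IsMarkovKernel κ ∧ ∀ s t u, MeasurableSet s → MeasurableSet t →
        MeasurableSet u → μ (k ⁻¹' s ∩ g ⁻¹' t ∩ f ⁻¹' u) =
          ∫⁻ ω in k ⁻¹' s ∩ g ⁻¹' t, κ (k ω) u ∂μ := by
  have hkg : Measurable fun ω => (k ω, g ω) := hk.prodMk hg
  have key (κ : Kernel γ α) [IsMarkovKernel κ] :
      μ.map (fun ω => ((k ω, g ω), f ω)) = μ.map (fun ω => (k ω, g ω)) ⊗ₘ κ.prodMkRight β ↔
        ∀ s t u, MeasurableSet s → MeasurableSet t → MeasurableSet u →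
          μ (k ⁻¹' s ∩ g ⁻¹' t ∩ f ⁻¹' u) = ∫⁻ ω in k ⁻¹' s ∩ g ⁻¹' t, κ (k ω) u ∂μ := by
    rw [Measure.ext_prod₃_iff']
    refine forall_congr' fun s => forall_congr' fun t => forall_congr' fun u =>
      forall_congr' fun hs => forall_congr' fun ht => forall_congr' fun hu => ?_
    rw [Measure.map_apply (hkg.prodMk hf) ((hs.prod ht).prod hu),
      Measure.compProd_apply_prod (hs.prod ht) hu,
      setLIntegral_map (hs.prod ht) (Kernel.measurable_coe _ hu) hkg]
    rfl
  rw [condIndepFun_iff_condDistrib_prod_ae_eq_prodMkRight hf hg hk]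
  constructor
  · intro h
    refine ⟨condDistrib f k μ, inferInstance, (key _).1 ?_⟩
    exact (condDistrib_ae_eq_iff_measure_eq_compProd _ hf.aemeasurable _).1 h
  · rintro ⟨κ, hκ, h⟩
    have h1 : condDistrib f (fun ω => (k ω, g ω)) μ =ᵐ[μ.map fun ω => (k ω, g ω)]
        κ.prodMkRight β :=
      (condDistrib_ae_eq_iff_measure_eq_compProd _ hf.aemeasurable _).2 ((key κ).2 h)
    have h2 : condDistrib f k μ =ᵐ[μ.map k] κ := by
      rw [condDistrib_ae_eq_iff_measure_eq_compProd _ hf.aemeasurable]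
      refine Measure.ext_prod fun {s u} hs hu => ?_
      rw [Measure.map_apply (hk.prodMk hf) (hs.prod hu), Measure.compProd_apply_prod hs hu,
        setLIntegral_map hs (Kernel.measurable_coe _ hu) hk]
      simpa [Set.mk_preimage_prod] using h s Set.univ u hs .univ hu
    have h3 : ∀ᵐ x ∂μ.map (fun ω => (k ω, g ω)), condDistrib f k μ x.1 = κ x.1 := by
      have : μ.map k = (μ.map fun ω => (k ω, g ω)).map Prod.fst := by
        rw [Measure.map_map measurable_fst hkg]; rfl
      rw [this] at h2
      exact ae_of_ae_map measurable_fst.aemeasurable h2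
    filter_upwards [h1, h3] with x hx1 hx3
    rw [hx1, Kernel.prodMkRight_apply, Kernel.prodMkRight_apply, hx3]

lemma coordSigma_singleton {X : Fin (n+1) → Type*} [∀ i, MeasurableSpace (X i)] (i : Fin (n+1)) :
    coordSigma (X := X) {i} = MeasurableSpace.comap (fun ω => ω i) inferInstance := by
  simp [coordSigma]

lemma coordSigma_eq_comap_domRestrict {X : Fin (n+1) → Type*} [∀ i, MeasurableSpace (X i)]
    (A : Set (Fin (n+1))) :
    coordSigma (X := X) A = MeasurableSpace.comap A.domRestrict inferInstance := by
  simp only [coordSigma, MeasurableSpace.pi, MeasurableSpace.comap_iSup,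
    MeasurableSpace.comap_comp, iSup_subtype']
  rfl

/-- `κ` is a conditional distribution under `p` of the coordinate `t + 1` given all coordinates
up to `t`. -/
def IsTransitionKernel {X : Fin (n+1) → Type*} [∀ i, MeasurableSpace (X i)]
    (p : Measure (∀ i, X i)) (t : Fin n) (κ : Kernel (X t.castSucc) (X t.succ)) : Prop :=
  ∀ S : ∀ i, Set (X i), (∀ i, MeasurableSet (S i)) → ∀ u, MeasurableSet u →
    p ((Set.Iic t.castSucc).pi S ∩ (fun ω => ω t.succ) ⁻¹' u) =
      ∫⁻ ω in (Set.Iic t.castSucc).pi S, κ (ω t.castSucc) u ∂p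

section

variable {X : Fin (n+1) → Type*} [∀ i, MeasurableSpace (X i)]

lemma measurableSet_cylinder {S : ∀ i, Set (X i)} (hS : ∀ i, MeasurableSet (S i))
    (A : Set (Fin (n+1))) : MeasurableSet (A.pi S) :=
  .pi A.to_countable fun i _ => hS i

/-- A transition kernel is determined by its behaviour on cylinder sets. -/
lemma IsTransitionKernel.measure_inter {p : Measure (∀ i, X i)} [IsFiniteMeasure p] {t : Fin n}
    {κ : Kernel (X t.castSucc) (X t.succ)} [IsMarkovKernel κ] (h : IsTransitionKernel p t κ)
    {s : Set (X t.castSucc)} {r : Set (∀ i : Set.Iio t.castSucc, X i)} {u : Set (X t.succ)}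
    (hs : MeasurableSet s) (hr : MeasurableSet r) (hu : MeasurableSet u) :
    p ((fun ω => ω t.castSucc) ⁻¹' s ∩ (Set.Iio t.castSucc).domRestrict ⁻¹' r ∩
        (fun ω => ω t.succ) ⁻¹' u) =
      ∫⁻ ω in (fun ω => ω t.castSucc) ⁻¹' s ∩ (Set.Iio t.castSucc).domRestrict ⁻¹' r,
        κ (ω t.castSucc) u ∂p := by
  have hg : Measurable ((Set.Iio t.castSucc).domRestrict (π := X)) :=
    measurable_pi_lambda _ fun i => measurable_pi_apply _
  have hs' : MeasurableSet ((fun ω : ∀ i, X i => ω t.castSucc) ⁻¹' s) := measurable_pi_apply _ hs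
  have hu' : MeasurableSet ((fun ω : ∀ i, X i => ω t.succ) ⁻¹' u) := measurable_pi_apply _ hu
  set a := (fun ω : ∀ i, X i => ω t.castSucc) ⁻¹' s with ha
  set b := (fun ω : ∀ i, X i => ω t.succ) ⁻¹' u
  let ν₁ := (p.restrict (a ∩ b)).map (Set.Iio t.castSucc).domRestrict
  let ν₂ := ((p.restrict a).withDensity fun ω => κ (ω t.castSucc) u).map
    (Set.Iio t.castSucc).domRestrict
  have hν₁ {r} (hr : MeasurableSet r) :
      ν₁ r = p (a ∩ (Set.Iio t.castSucc).domRestrict ⁻¹' r ∩ b) := by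
    rw [Measure.map_apply hg hr, Measure.restrict_apply (hg hr)]
    congr 1
    ext; simp only [Set.mem_inter_iff]; tauto
  have hν₂ {r} (hr : MeasurableSet r) : ν₂ r =
      ∫⁻ ω in a ∩ (Set.Iio t.castSucc).domRestrict ⁻¹' r, κ (ω t.castSucc) u ∂p := by
    rw [Measure.map_apply hg hr, withDensity_apply _ (hg hr), Measure.restrict_restrict (hg hr),
      Set.inter_comm]
  have hrect (R : ∀ i : Set.Iio t.castSucc, Set (X i)) (hR : ∀ i, MeasurableSet (R i)) :
      ν₁ (Set.univ.pi R) = ν₂ (Set.univ.pi R) := by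
    rw [hν₁ (.univ_pi hR), hν₂ (.univ_pi hR)]
    let S : ∀ i, Set (X i) := fun i =>
      {x | (∀ hi : i < t.castSucc, x ∈ R ⟨i, hi⟩) ∧ ∀ hi : i = t.castSucc, hi ▸ x ∈ s}
    have hS i : MeasurableSet (S i) := by
      rcases lt_trichotomy i t.castSucc with hi | hi | hi
      · simpa [S, hi, hi.ne] using hR ⟨i, hi⟩
      · subst hi; simpa [S] using hs
      · simp [S, hi.ne', hi.not_gt]
    have hSeq : (Set.Iic t.castSucc).pi S =
        a ∩ (Set.Iio t.castSucc).domRestrict ⁻¹' Set.univ.pi R := by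
      ext ω
      simp only [Set.mem_pi, Set.mem_Iic, Set.mem_inter_iff, Set.mem_preimage, Set.mem_univ,
        true_imp_iff, ha, S, Set.mem_ofPred_eq, Subtype.forall, Set.mem_Iio]
      constructor
      · intro H
        exact ⟨(H _ le_rfl).2 rfl, fun i hi => (H i hi.le).1 hi⟩
      · rintro ⟨H1, H2⟩ i -
        refine ⟨fun hi => H2 i hi, ?_⟩
        rintro rfl
        exact H1
    rw [← hSeq]
    exact h S hS u hu
  have hν : ν₁ = ν₂ := by
    refine ext_of_generate_finite _ generateFrom_pi.symm isPiSystem_pi ?_ ?_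
    · rintro _ ⟨R, hR, rfl⟩
      exact hrect R fun i => hR i (Set.mem_univ i)
    · simpa using hrect (fun _ => Set.univ) fun _ => .univ
  rw [← hν₁ hr, ← hν₂ hr, hν]

lemma condIndepCoords_iff_exists_isTransitionKernel [∀ i, StandardBorelSpace (X i)]
    (p : Measure (∀ i, X i)) [IsProbabilityMeasure p] (t : Fin n) :
    CondIndepCoords p {t.castSucc} {t.succ} (Set.Iio t.castSucc) ↔
      ∃ κ : Kernel (X t.castSucc) (X t.succ), IsMarkovKernel κ ∧ IsTransitionKernel p t κ := by
  obtain ⟨ω₀⟩ := nonempty_of_isProbabilityMeasure p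
  have : ∀ i, Nonempty (X i) := fun i => ⟨ω₀ i⟩
  have hg : Measurable ((Set.Iio t.castSucc).domRestrict (π := X)) :=
    measurable_pi_lambda _ fun i => measurable_pi_apply _
  have hk : Measurable fun ω : ∀ i, X i => ω t.castSucc := measurable_pi_apply _
  have hf : Measurable fun ω : ∀ i, X i => ω t.succ := measurable_pi_apply _
  have hCI : CondIndepCoords p {t.castSucc} {t.succ} (Set.Iio t.castSucc) ↔
      CondIndepFun (MeasurableSpace.comap (fun ω : ∀ i, X i => ω t.castSucc) inferInstance)
        hk.comap_le (Set.Iio t.castSucc).domRestrict (fun ω => ω t.succ) p := by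
    rw [condIndepFun_iff_condIndep, CondIndepCoords]
    simp only [coordSigma_singleton, coordSigma_eq_comap_domRestrict (Set.Iio _)]
    exact ⟨CondIndep.symm, CondIndep.symm⟩
  rw [hCI, condIndepFun_iff_exists_kernel hf hg hk]
  refine exists_congr fun κ => and_congr_right fun hκ => ⟨fun h S hS u hu => ?_,
    fun h s r u hs hr hu => h.measure_inter hs hr hu⟩
  have hSeq : (Set.Iic t.castSucc).pi S = (fun ω => ω t.castSucc) ⁻¹' S t.castSucc ∩
      (Set.Iio t.castSucc).domRestrict ⁻¹' Set.univ.pi fun i => S i := by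
    ext ω
    simp only [Set.mem_pi, Set.mem_Iic, Set.mem_inter_iff, Set.mem_preimage, Set.mem_univ,
      true_imp_iff, Subtype.forall, Set.mem_Iio, le_iff_lt_or_eq, or_imp,
      forall_and, forall_eq]
    exact and_comm
  rw [hSeq]
  exact h _ _ u (hS _) (.univ_pi fun i => hS i) hu

variable (f : ∀ t : Fin n, Kernel (X t.castSucc) (X t.succ)) (f₀ : Measure (X 0))

/-- The forward measures of a Markov chain killed upon leaving the sets `S`: the measure of `u`
at time `t` is the mass of the paths lying in `S 0, …, S t` and ending in `u`. -/
noncomputable def mcForward (S : ∀ i, Set (X i)) : ∀ t : Fin (n+1), Measure (X t) :=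
  Fin.induction (f₀.restrict (S 0)) (fun t ν => (ν.bind (f t)).restrict (S t.succ))

lemma mcForward_zero (S : ∀ i, Set (X i)) : mcForward f f₀ S 0 = f₀.restrict (S 0) := rfl

lemma mcForward_succ (S : ∀ i, Set (X i)) (t : Fin n) :
    mcForward f f₀ S t.succ = ((mcForward f f₀ S t.castSucc).bind (f t)).restrict (S t.succ) :=
  rfl

lemma mcForward_congr {S S' : ∀ i, Set (X i)} (t : Fin (n+1)) (h : ∀ i ≤ t, S i = S' i) :
    mcForward f f₀ S t = mcForward f f₀ S' t := by
  induction t using Fin.induction with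
  | zero => rw [mcForward_zero, mcForward_zero, h 0 le_rfl]
  | succ t ih =>
    rw [mcForward_succ, mcForward_succ, h _ le_rfl,
      ih fun i hi => h i (hi.trans Fin.castSucc_lt_succ.le)]

lemma mcBack_last (S : ∀ i, Set (X i)) : mcBack f S (Fin.last n) = fun _ => 1 := by
  simp [mcBack]

lemma mcBack_castSucc (S : ∀ i, Set (X i)) (t : Fin n) :
    mcBack f S t.castSucc = fun x => ∫⁻ x' in S t.succ, mcBack f S t.succ x' ∂(f t x) := by
  simp [mcBack]

lemma measurable_mcBack [∀ t, IsMarkovKernel (f t)] {S : ∀ i, Set (X i)}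
    (hS : ∀ i, MeasurableSet (S i)) (t : Fin (n+1)) :
    Measurable (mcBack f S t) := by
  induction t using Fin.reverseInduction with
  | last => rw [mcBack_last]; exact measurable_const
  | cast t ih =>
    rw [mcBack_castSucc]
    exact ih.setLIntegral_kernel (hS _)

lemma mcBack_eq_one [∀ t, IsMarkovKernel (f t)] {S : ∀ i, Set (X i)} (t : Fin (n+1))
    (h : ∀ i, t < i → S i = Set.univ) : mcBack f S t = fun _ => 1 := by
  induction t using Fin.reverseInduction with
  | last => exact mcBack_last f S
  | cast t ih =>
    rw [mcBack_castSucc, ih fun i hi => h i (Fin.castSucc_lt_succ.trans hi),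
      h _ Fin.castSucc_lt_succ]
    simp

lemma lintegral_mcBack_mcForward [∀ t, IsMarkovKernel (f t)] {S : ∀ i, Set (X i)}
    (hS : ∀ i, MeasurableSet (S i)) (t : Fin (n+1)) :
    ∫⁻ x, mcBack f S t x ∂(mcForward f f₀ S t) = ∫⁻ x in S 0, mcBack f S 0 x ∂f₀ := by
  induction t using Fin.induction with
  | zero => rfl
  | succ t ih =>
    rw [← ih, mcBack_castSucc, mcForward_succ, ← lintegral_indicator (hS _),
      Measure.lintegral_bind (f t).aemeasurable
        ((measurable_mcBack f hS _).indicator (hS _)).aemeasurable]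
    simp_rw [lintegral_indicator (hS _)]

variable {f f₀} {p : Measure (∀ i, X i)}

/-- If the `f t` are transition kernels of `p`, then the forward measures are the laws under `p` of
the coordinates restricted to cylinder sets. -/
lemma map_restrict_cylinder_eq_mcForward (h₀ : p.map (fun ω => ω 0) = f₀)
    (hf : ∀ t, IsTransitionKernel p t (f t)) {S : ∀ i, Set (X i)}
    (hS : ∀ i, MeasurableSet (S i)) (t : Fin (n+1)) :
    (p.restrict ((Set.Iic t).pi S)).map (fun ω => ω t) = mcForward f f₀ S t := by
  induction t using Fin.induction with
  | zero =>
    rw [mcForward_zero, ← h₀, Measure.restrict_map (measurable_pi_apply _) (hS 0)]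
    congr 2
    ext ω
    simp [Set.mem_pi]
  | succ t ih =>
    rw [mcForward_succ, ← ih]
    ext u hu
    have hc := measurableSet_cylinder hS (Set.Iic t.castSucc)
    rw [Measure.map_apply (measurable_pi_apply _) hu,
      Measure.restrict_apply (measurable_pi_apply _ hu), Measure.restrict_apply hu,
      Measure.bind_apply (hu.inter (hS _)) (f t).aemeasurable,
      lintegral_map ((f t).measurable_coe (hu.inter (hS _))) (measurable_pi_apply _),
      ← hf t S hS _ (hu.inter (hS _))]
    congr 1
    ext ω
    simp only [Set.mem_inter_iff, Set.mem_preimage, Set.mem_pi, Set.mem_Iic]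
    constructor
    · rintro ⟨h1, h2⟩
      exact ⟨fun i hi => h2 i (hi.trans Fin.castSucc_lt_succ.le), h1, h2 _ le_rfl⟩
    · rintro ⟨h1, h2, h3⟩
      refine ⟨h2, fun i hi => ?_⟩
      rcases hi.lt_or_eq with hi | rfl
      · exact h1 i (Fin.le_castSucc_iff.2 hi)
      · exact h3

lemma measure_pi_eq_of_isTransitionKernel [∀ t, IsMarkovKernel (f t)]
    (h₀ : p.map (fun ω => ω 0) = f₀) (hf : ∀ t, IsTransitionKernel p t (f t)) {S : ∀ i, Set (X i)}
    (hS : ∀ i, MeasurableSet (S i)) :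
    p (Set.univ.pi S) = ∫⁻ x in S 0, mcBack f S 0 x ∂f₀ := by
  rw [← lintegral_mcBack_mcForward f f₀ hS (Fin.last n), mcBack_last, lintegral_const, one_mul,
    ← map_restrict_cylinder_eq_mcForward h₀ hf hS, Measure.map_apply (measurable_pi_apply _) .univ,
    Set.preimage_univ, Measure.restrict_apply_univ]
  congr 1
  ext ω
  simp [Set.mem_pi, Fin.le_last]

lemma measure_cylinder_eq_mcForward [∀ t, IsMarkovKernel (f t)]
    (hp : ∀ S : ∀ i, Set (X i), (∀ i, MeasurableSet (S i)) →
      p (Set.univ.pi S) = ∫⁻ x in S 0, mcBack f S 0 x ∂f₀)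
    {S : ∀ i, Set (X i)} (hS : ∀ i, MeasurableSet (S i)) (t : Fin (n+1)) :
    p ((Set.Iic t).pi S) = mcForward f f₀ S t Set.univ := by
  let S' : ∀ i, Set (X i) := fun i => {x | i ≤ t → x ∈ S i}
  have hle i (hi : i ≤ t) : S' i = S i := by simp [S', hi]
  have hlt i (hi : t < i) : S' i = Set.univ := by simp [S', hi.not_ge]
  have hS' i : MeasurableSet (S' i) := by
    rcases le_or_gt i t with hi | hi
    · exact hle i hi ▸ hS i
    · exact hlt i hi ▸ .univ
  have hpi : (Set.Iic t).pi S = Set.univ.pi S' := by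
    ext ω
    simp [S', Set.mem_pi]
  rw [hpi, hp S' hS', ← lintegral_mcBack_mcForward f f₀ hS' t, mcBack_eq_one f t hlt,
    lintegral_const, one_mul, mcForward_congr f f₀ t hle]

lemma map_restrict_cylinder_eq_mcForward_of_factorization [∀ t, IsMarkovKernel (f t)]
    (hp : ∀ S : ∀ i, Set (X i), (∀ i, MeasurableSet (S i)) →
      p (Set.univ.pi S) = ∫⁻ x in S 0, mcBack f S 0 x ∂f₀)
    {S : ∀ i, Set (X i)} (hS : ∀ i, MeasurableSet (S i)) (t : Fin (n+1)) :
    (p.restrict ((Set.Iic t).pi S)).map (fun ω => ω t) = mcForward f f₀ S t := by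
  ext u hu
  let S' : ∀ i, Set (X i) := Function.update S t (S t ∩ u)
  have hS' i : MeasurableSet (S' i) := by
    rcases eq_or_ne i t with rfl | hi
    · simpa [S'] using (hS i).inter hu
    · simpa [S', hi] using hS i
  have hpi : (fun ω => ω t) ⁻¹' u ∩ (Set.Iic t).pi S = (Set.Iic t).pi S' := by
    ext ω
    simp only [Set.mem_inter_iff, Set.mem_preimage, Set.mem_pi, Set.mem_Iic]
    constructor
    · rintro ⟨h1, h2⟩ i hi
      rcases eq_or_ne i t with rfl | hi'
      · simpa [S'] using ⟨h2 i hi, h1⟩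
      · simpa [S', hi'] using h2 i hi
    · intro h
      have ht : ω t ∈ S t ∩ u := by simpa [S'] using h t le_rfl
      refine ⟨ht.2, fun i hi => ?_⟩
      rcases eq_or_ne i t with rfl | hi'
      · exact ht.1
      · simpa [S', hi'] using h i hi
  rw [Measure.map_apply (measurable_pi_apply _) hu,
    Measure.restrict_apply (measurable_pi_apply _ hu), hpi,
    measure_cylinder_eq_mcForward hp hS']
  cases t using Fin.cases with
  | zero => simp [mcForward_zero, S', Measure.restrict_apply hu, Set.inter_comm]
  | succ t =>
    have hc : mcForward f f₀ S' t.castSucc = mcForward f f₀ S t.castSucc :=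
      mcForward_congr f f₀ _ fun i hi => by
        simp [S', (hi.trans_lt Fin.castSucc_lt_succ).ne]
    rw [mcForward_succ, mcForward_succ, hc, Measure.restrict_apply_univ,
      Measure.restrict_apply hu]
    simp [S', Set.inter_comm]

lemma isTransitionKernel_of_factorization [∀ t, IsMarkovKernel (f t)]
    (hp : ∀ S : ∀ i, Set (X i), (∀ i, MeasurableSet (S i)) →
      p (Set.univ.pi S) = ∫⁻ x in S 0, mcBack f S 0 x ∂f₀)
    (t : Fin n) : IsTransitionKernel p t (f t) := by
  intro S hS u hu
  let S' : ∀ i, Set (X i) := Function.update S t.succ u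
  have hS' i : MeasurableSet (S' i) := by
    rcases eq_or_ne i t.succ with rfl | hi
    · simpa [S'] using hu
    · simpa [S', hi] using hS i
  have hne i (hi : i ≤ t.castSucc) : S' i = S i := by
    simp [S', (hi.trans_lt Fin.castSucc_lt_succ).ne]
  have hpi : (Set.Iic t.castSucc).pi S ∩ (fun ω => ω t.succ) ⁻¹' u = (Set.Iic t.succ).pi S' := by
    ext ω
    simp only [Set.mem_inter_iff, Set.mem_preimage, Set.mem_pi, Set.mem_Iic]
    constructor
    · rintro ⟨h1, h2⟩ i hi
      rcases hi.lt_or_eq with hi | rfl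
      · have hi := Fin.le_castSucc_iff.2 hi
        exact hne i hi ▸ h1 i hi
      · simpa [S'] using h2
    · intro h
      refine ⟨fun i hi => hne i hi ▸ h i (hi.trans Fin.castSucc_lt_succ.le), ?_⟩
      simpa [S'] using h _ le_rfl
  rw [hpi, measure_cylinder_eq_mcForward hp hS', mcForward_succ, mcForward_congr f f₀ _ hne,
    Measure.restrict_apply_univ, ← map_restrict_cylinder_eq_mcForward_of_factorization hp hS,
    Measure.bind_apply (hS' _) (f t).aemeasurable,
    lintegral_map ((f t).measurable_coe (hS' _)) (measurable_pi_apply _)]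
  simp [S']

end

/-- **Equivalence of the local Markov property and the Markov chain factorization**
(Proposition `MarkovChainMarkovProps`, (a) ⇔ (c), instantiated in `BorelStoch`). -/
theorem localMarkov_iff_factorizesAsMarkovChain
    {X : Fin (n+1) → Type*} [∀ i, MeasurableSpace (X i)] [∀ i, StandardBorelSpace (X i)]
    (p : Measure (∀ i, X i)) [IsProbabilityMeasure p] :
    (∀ (t : ℕ) (ht1 : 1 ≤ t) (ht2 : t ≤ n),
      CondIndepCoords p {(⟨t - 1, by omega⟩ : Fin (n+1))}
        {(⟨t, by omega⟩ : Fin (n+1))} {i : Fin (n+1) | (i : ℕ) + 2 ≤ t})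
    ↔ FactorizesAsMarkovChain p := by
  have hpast (t : Fin n) : {i : Fin (n+1) | (i : ℕ) + 2 ≤ (t : ℕ) + 1} = Set.Iio t.castSucc := by
    ext i
    simp only [Set.mem_ofPred_eq, Set.mem_Iio, Fin.lt_def, Fin.val_castSucc]
    omega
  constructor
  · intro h
    have hker (t : Fin n) := (condIndepCoords_iff_exists_isTransitionKernel p t).1
      (hpast t ▸ h (t + 1) (by omega) (by omega))
    choose f hf hft using hker
    exact ⟨p.map (fun ω => ω 0),
      Measure.isProbabilityMeasure_map (measurable_pi_apply _).aemeasurable, f, hf,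
      fun S hS => measure_pi_eq_of_isTransitionKernel rfl hft hS⟩
  · rintro ⟨f₀, -, f, hf, hp⟩ t ht1 ht2
    obtain ⟨t, rfl⟩ : ∃ s : Fin n, t = s + 1 := ⟨⟨t - 1, by omega⟩, by simp; omega⟩
    rw [hpast]
    exact (condIndepCoords_iff_exists_isTransitionKernel p t).2
      ⟨f t, hf t, isTransitionKernel_of_factorization hp t⟩

end MarkovChainStmt
end

section
/- Let q be a probability measure on ∏_{t=0}^n (X_t × Y_t) with all X_t, Y_t standard Borel. Then q satisfies the backward Markov property — for every 1 ≤ t ≤ n: (a) the coordinate X_t is conditionally independent of the coordinates (X_0, …, X_{t-2}, Y_0, …, Y_{t-1}) given X_{t-1} under q, and (b) the coordinate Y_t is conditionally independent of the coordinates (X_0, …, X_{t-1}, Y_0, …, Y_{t-1}) given X_t under q — if and only if there exist an initial distribution f_0, transition kernels (f_t)_{t=1}^n and observation kernels (g_t)_{t=0}^n such that q equals the associated hidden Markov model measure p. -/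
open MeasureTheory ProbabilityTheory
open scoped ENNReal

namespace HMMStmt

variable {n : ℕ}

/-- The σ-algebra on `∀ i, X i × Y i` generated by the hidden-state coordinates in `A`
together with the observation coordinates in `B`. -/
def coordSigma {X Y : Fin (n+1) → Type*} [∀ i, MeasurableSpace (X i)]
    [∀ i, MeasurableSpace (Y i)] (A B : Set (Fin (n+1))) :
    MeasurableSpace (∀ i, X i × Y i) :=
  (⨆ i ∈ A, MeasurableSpace.comap (fun ω => (ω i).1) inferInstance) ⊔
    (⨆ j ∈ B, MeasurableSpace.comap (fun ω => (ω j).2) inferInstance)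

lemma coordSigma_le {X Y : Fin (n+1) → Type*} [∀ i, MeasurableSpace (X i)]
    [∀ i, MeasurableSpace (Y i)] (A B : Set (Fin (n+1))) :
    coordSigma (X := X) (Y := Y) A B ≤ MeasurableSpace.pi := by
  refine sup_le ?_ ?_
  · exact iSup_le fun i => iSup_le fun _ => ((measurable_pi_apply i).fst).comap_le
  · exact iSup_le fun j => iSup_le fun _ => ((measurable_pi_apply j).snd).comap_le

/-- Conditional independence (in the sense of `ProbabilityTheory.CondIndep`) under `p` of
the coordinates `((X_r)_{r ∈ A}, (Y_u)_{u ∈ A'})` from `((X_t)_{t ∈ B}, (Y_w)_{w ∈ B'})`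
given `((X_s)_{s ∈ C}, (Y_v)_{v ∈ C'})`. -/
def CondIndepCoords {X Y : Fin (n+1) → Type*} [∀ i, MeasurableSpace (X i)]
    [∀ i, MeasurableSpace (Y i)] [∀ i, StandardBorelSpace (X i)]
    [∀ i, StandardBorelSpace (Y i)]
    (p : Measure (∀ i, X i × Y i)) [IsFiniteMeasure p]
    (C C' A A' B B' : Set (Fin (n+1))) : Prop :=
  CondIndep (coordSigma C C') (coordSigma A A') (coordSigma B B') (coordSigma_le C C') p

/-- Backward value function computing the iterated integral
`∫_{S_{t+1}} g_{t+1}(T_{t+1}|x_{t+1}) ⋯ (∫_{S_n} g_n(T_n|x_n) f_n(dx_n|x_{n-1})) ⋯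
f_{t+1}(dx_{t+1}|x_t)` times `g_t(T_t | x_t)`, as a function of `x_t`. -/
noncomputable def hmmBack {X Y : Fin (n+1) → Type*} [∀ i, MeasurableSpace (X i)]
    [∀ i, MeasurableSpace (Y i)]
    (f : ∀ t : Fin n, Kernel (X t.castSucc) (X t.succ))
    (g : ∀ t : Fin (n+1), Kernel (X t) (Y t))
    (S : ∀ i, Set (X i)) (T : ∀ i, Set (Y i)) : ∀ t : Fin (n+1), X t → ℝ≥0∞ :=
  Fin.reverseInduction (fun x => g (Fin.last n) x (T (Fin.last n)))
    (fun i ih x => g i.castSucc x (T i.castSucc) * ∫⁻ x' in S i.succ, ih x' ∂ (f i x))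

/-- `p` is the hidden Markov model measure associated with the initial distribution `f₀`,
the transition kernels `f` and the observation kernels `g`: for all measurable sets,
`p (∏ t, S_t × T_t) = ∫_{S_0} ⋯ ∫_{S_n} ∏_t g_t(T_t|x_t) f_n(dx_n|x_{n-1}) ⋯ f_0(dx_0)`. -/
def IsHMM {X Y : Fin (n+1) → Type*} [∀ i, MeasurableSpace (X i)]
    [∀ i, MeasurableSpace (Y i)] (p : Measure (∀ i, X i × Y i))
    (f₀ : Measure (X 0)) (f : ∀ t : Fin n, Kernel (X t.castSucc) (X t.succ))
    (g : ∀ t : Fin (n+1), Kernel (X t) (Y t)) : Prop :=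
  ∀ (S : ∀ i, Set (X i)) (T : ∀ i, Set (Y i)),
    (∀ i, MeasurableSet (S i)) → (∀ i, MeasurableSet (T i)) →
      p (Set.univ.pi fun i => (S i) ×ˢ (T i)) = ∫⁻ x₀ in S 0, hmmBack f g S T 0 x₀ ∂ f₀

section CondKernel

variable {Ω 𝓩 𝓦 : Type*} {m m' : MeasurableSpace Ω} {mΩ : MeasurableSpace Ω} [MeasurableSpace 𝓩] [MeasurableSpace 𝓦]
  {μ : Measure Ω} {Z : Ω → 𝓩} {W : Ω → 𝓦} {κ : Kernel 𝓩 𝓦}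

/-- `κ` is a version of the conditional law of `W` given `Z`, also after conditioning on any
event of the σ-algebra `m`. -/
def IsCondKernelGiven (m : MeasurableSpace Ω) {mΩ : MeasurableSpace Ω} (μ : Measure Ω)
    (Z : Ω → 𝓩) (W : Ω → 𝓦) (κ : Kernel 𝓩 𝓦) : Prop :=
  ∀ A, MeasurableSet[m] A →
    (μ.restrict A).map (fun ω => (Z ω, W ω)) = (μ.restrict A).map Z ⊗ₘ κ

lemma IsCondKernelGiven.setLIntegral_eq [IsFiniteMeasure μ] [IsMarkovKernel κ]
    (h : IsCondKernelGiven m μ Z W κ) (hZ : Measurable Z) (hW : Measurable W)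
    {A : Set Ω} (hA : MeasurableSet[m] A) {C : Set 𝓩} (hC : MeasurableSet C)
    {D : Set 𝓦} (hD : MeasurableSet D) {φ : 𝓩 × 𝓦 → ℝ≥0∞} (hφ : Measurable φ) :
    ∫⁻ ω in A ∩ (Z ⁻¹' C ∩ W ⁻¹' D), φ (Z ω, W ω) ∂μ =
      ∫⁻ ω in A ∩ Z ⁻¹' C, ∫⁻ w in D, φ (Z ω, w) ∂(κ (Z ω)) ∂μ := by
  have hφD : Measurable fun z => ∫⁻ w in D, φ (z, w) ∂(κ z) :=
    Measurable.setLIntegral_kernel_prod_right (f := fun z w => φ (z, w)) hφ hD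
  calc ∫⁻ ω in A ∩ (Z ⁻¹' C ∩ W ⁻¹' D), φ (Z ω, W ω) ∂μ
      = ∫⁻ ω in (fun ω => (Z ω, W ω)) ⁻¹' (C ×ˢ D), φ (Z ω, W ω) ∂(μ.restrict A) := by
        rw [Measure.restrict_restrict (hZ.prodMk hW (hC.prod hD)), Set.inter_comm]
        rfl
    _ = ∫⁻ p in C ×ˢ D, φ p ∂((μ.restrict A).map Z ⊗ₘ κ) := by
        rw [← h A hA, setLIntegral_map (hC.prod hD) hφ (hZ.prodMk hW)]
    _ = ∫⁻ ω in Z ⁻¹' C, ∫⁻ w in D, φ (Z ω, w) ∂(κ (Z ω)) ∂(μ.restrict A) := by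
        rw [Measure.setLIntegral_compProd hφ hC hD, setLIntegral_map hC hφD hZ]
    _ = ∫⁻ ω in A ∩ Z ⁻¹' C, ∫⁻ w in D, φ (Z ω, w) ∂(κ (Z ω)) ∂μ := by
        rw [Measure.restrict_restrict (hZ hC), Set.inter_comm]

lemma map_restrict_eq_compProd_iff [IsFiniteMeasure μ] [IsMarkovKernel κ]
    (hZ : Measurable Z) (hW : Measurable W) (A : Set Ω) :
    (μ.restrict A).map (fun ω => (Z ω, W ω)) = (μ.restrict A).map Z ⊗ₘ κ ↔
      ∀ C D, MeasurableSet C → MeasurableSet D →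
        μ.restrict A (Z ⁻¹' C ∩ W ⁻¹' D) = ∫⁻ ω in Z ⁻¹' C, κ (Z ω) D ∂(μ.restrict A) := by
  rw [Measure.ext_prod_iff]
  have key : ∀ C D, MeasurableSet C → MeasurableSet D →
      ((μ.restrict A).map (fun ω => (Z ω, W ω)) (C ×ˢ D) =
          μ.restrict A (Z ⁻¹' C ∩ W ⁻¹' D) ∧
        ((μ.restrict A).map Z ⊗ₘ κ) (C ×ˢ D) =
          ∫⁻ ω in Z ⁻¹' C, κ (Z ω) D ∂(μ.restrict A)) := by
    intro C D hC hD
    rw [Measure.map_apply (hZ.prodMk hW) (hC.prod hD), Measure.compProd_apply_prod hC hD,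
      setLIntegral_map hC (κ.measurable_coe hD) hZ]
    exact ⟨rfl, rfl⟩
  refine ⟨fun h C D hC hD => ?_, fun h C D hC hD => ?_⟩
  · rw [← (key C D hC hD).1, ← (key C D hC hD).2, h hC hD]
  · rw [(key C D hC hD).1, (key C D hC hD).2, h C D hC hD]

lemma isCondKernelGiven_of_generateFrom [IsFiniteMeasure μ] [IsMarkovKernel κ]
    (hZ : Measurable Z) (hW : Measurable W) (hm : m ≤ mΩ) {𝒞 : Set (Set Ω)}
    (hgen : m = MeasurableSpace.generateFrom 𝒞) (hpi : IsPiSystem 𝒞) (huniv : Set.univ ∈ 𝒞)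
    (h : ∀ A ∈ 𝒞, ∀ C D, MeasurableSet C → MeasurableSet D →
      μ (A ∩ (Z ⁻¹' C ∩ W ⁻¹' D)) = ∫⁻ ω in A ∩ Z ⁻¹' C, κ (Z ω) D ∂μ) :
    IsCondKernelGiven m μ Z W κ := by
  intro A hA
  rw [map_restrict_eq_compProd_iff hZ hW]
  intro C D hC hD
  have hE := (hZ hC).inter (hW hD)
  have hEq : ∀ B ∈ 𝒞, μ.restrict (Z ⁻¹' C ∩ W ⁻¹' D) B =
      (μ.restrict (Z ⁻¹' C)).withDensity (fun ω => κ (Z ω) D) B := by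
    intro B hB
    have hBm : MeasurableSet B := hm _ (hgen ▸ MeasurableSpace.measurableSet_generateFrom hB)
    rw [Measure.restrict_apply hBm, h B hB C D hC hD, withDensity_apply _ hBm,
      Measure.restrict_restrict hBm]
  have := ext_on_measurableSpace_of_generate_finite mΩ 𝒞 hEq hm hgen hpi
    (hEq _ huniv) hA
  rw [Measure.restrict_apply (hm _ hA), withDensity_apply _ (hm _ hA),
    Measure.restrict_restrict (hm _ hA)] at this
  rw [Measure.restrict_apply hE, Measure.restrict_restrict (hZ hC), Set.inter_comm, this,
    Set.inter_comm]

lemma condExp_ae_eq_iff_forall_setIntegral_eq (hm' : m' ≤ mΩ)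
    [IsFiniteMeasure μ] {f g : Ω → ℝ} (hf : Integrable f μ) (hg : Integrable g μ) :
    μ[f | m'] =ᵐ[μ] μ[g | m'] ↔
      ∀ s, MeasurableSet[m'] s → ∫ x in s, f x ∂μ = ∫ x in s, g x ∂μ := by
  refine ⟨fun h s hs => ?_, fun h => ?_⟩
  · rw [← setIntegral_condExp hm' hf hs, ← setIntegral_condExp hm' hg hs]
    exact setIntegral_congr_ae (hm' _ hs) (h.mono fun _ hx _ => hx)
  · refine ae_eq_condExp_of_forall_setIntegral_eq hm' hg
      (fun _ _ _ => integrable_condExp.integrableOn) (fun s hs _ => ?_)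
      stronglyMeasurable_condExp.aestronglyMeasurable
    rw [setIntegral_condExp hm' hf hs, h s hs]

lemma condIndep_comap_iff_isCondKernelGiven [StandardBorelSpace Ω] [StandardBorelSpace 𝓦]
    [Nonempty 𝓦] [IsFiniteMeasure μ] [IsMarkovKernel κ]
    (hZ : Measurable Z) (hW : Measurable W) (hm : m ≤ mΩ)
    (hκ : μ.map (fun ω => (Z ω, W ω)) = μ.map Z ⊗ₘ κ) :
    CondIndep (MeasurableSpace.comap Z inferInstance) (MeasurableSpace.comap W inferInstance) m
      hZ.comap_le μ ↔ IsCondKernelGiven m μ Z W κ := by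
  have hker : ∀ D, MeasurableSet D → (fun ω => (κ (Z ω)).real D) =ᵐ[μ]
      μ⟦W ⁻¹' D | MeasurableSpace.comap Z inferInstance⟧ := by
    intro D hD
    filter_upwards [condDistrib_ae_eq_condExp hZ hW hD (μ := μ),
      ae_of_ae_map hZ.aemeasurable (condDistrib_ae_eq_of_measure_eq_compProd Z hW.aemeasurable hκ)]
      with ω h1 h2
    rw [← h1, h2]
  have hmeasκ : ∀ D, MeasurableSet D → Measurable (fun z => (κ z).real D) :=
    fun D hD => (κ.measurable_coe hD).ennreal_toReal
  have hintegral : ∀ D A, MeasurableSet D → MeasurableSet[m] A →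
      Integrable ((fun ω => (κ (Z ω)).real D) * A.indicator (fun _ => (1 : ℝ))) μ := by
    intro D A hD hA
    refine Integrable.bdd_mul ((integrable_const _).indicator (hm _ hA)) (c := 1)
      ((hmeasκ D hD).comp hZ).aestronglyMeasurable (ae_of_all _ fun ω => ?_)
    simp [abs_of_nonneg, measureReal_le_one]
  rw [condIndep_iff _ _ _ hZ.comap_le hW.comap_le hm]
  have hpull : ∀ D A, MeasurableSet D → MeasurableSet[m] A →
      (μ⟦W ⁻¹' D | MeasurableSpace.comap Z inferInstance⟧) *
        (μ⟦A | MeasurableSpace.comap Z inferInstance⟧) =ᵐ[μ]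
      μ[(fun ω => (κ (Z ω)).real D) * A.indicator (fun _ => (1 : ℝ)) |
        MeasurableSpace.comap Z inferInstance] := by
    intro D A hD hA
    refine (Filter.EventuallyEq.mul (hker D hD).symm Filter.EventuallyEq.rfl).trans ?_
    exact (condExp_mul_of_stronglyMeasurable_left
      ((hmeasκ D hD).comp (comap_measurable Z)).stronglyMeasurable (hintegral D A hD hA)
      ((integrable_const _).indicator (hm _ hA))).symm
  have hset : ∀ D A, MeasurableSet D → MeasurableSet[m] A →
      ((μ⟦W ⁻¹' D ∩ A | MeasurableSpace.comap Z inferInstance⟧) =ᵐ[μ]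
        (μ⟦W ⁻¹' D | MeasurableSpace.comap Z inferInstance⟧) *
        (μ⟦A | MeasurableSpace.comap Z inferInstance⟧) ↔
      ∀ C, MeasurableSet C →
        μ.restrict A (Z ⁻¹' C ∩ W ⁻¹' D) = ∫⁻ ω in Z ⁻¹' C, κ (Z ω) D ∂(μ.restrict A)) := by
    intro D A hD hA
    have hAm := hm _ hA
    have hcong := (hpull D A hD hA)
    rw [show ((μ⟦W ⁻¹' D ∩ A | MeasurableSpace.comap Z inferInstance⟧) =ᵐ[μ]
        (μ⟦W ⁻¹' D | MeasurableSpace.comap Z inferInstance⟧) *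
        (μ⟦A | MeasurableSpace.comap Z inferInstance⟧)) ↔ _ from
        ⟨fun h => h.trans hcong, fun h => h.trans hcong.symm⟩,
      condExp_ae_eq_iff_forall_setIntegral_eq hZ.comap_le
        ((integrable_const _).indicator ((hW hD).inter hAm)) (hintegral D A hD hA)]
    have hC : ∀ C, MeasurableSet C →
        (∫ ω in Z ⁻¹' C, (W ⁻¹' D ∩ A).indicator (fun _ => (1 : ℝ)) ω ∂μ =
          ∫ ω in Z ⁻¹' C, ((fun ω => (κ (Z ω)).real D) * A.indicator (fun _ => (1 : ℝ))) ω ∂μ ↔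
        μ.restrict A (Z ⁻¹' C ∩ W ⁻¹' D) = ∫⁻ ω in Z ⁻¹' C, κ (Z ω) D ∂(μ.restrict A)) := by
      intro C hC
      have h1 : ∫ ω in Z ⁻¹' C, (W ⁻¹' D ∩ A).indicator (fun _ => (1 : ℝ)) ω ∂μ =
          (μ.restrict A (Z ⁻¹' C ∩ W ⁻¹' D)).toReal := by
        rw [integral_indicator_const _ ((hW hD).inter hAm),
          measureReal_restrict_apply ((hW hD).inter hAm),
          Measure.restrict_apply ((hZ hC).inter (hW hD))]
        simp only [smul_eq_mul, mul_one, measureReal_def]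
        congr 2
        ext ω
        simp only [Set.mem_inter_iff]
        tauto
      have h2 : ((fun ω => (κ (Z ω)).real D) * A.indicator (fun _ => (1 : ℝ))) =
          A.indicator (fun ω => (κ (Z ω)).real D) := by
        ext ω
        by_cases hω : ω ∈ A <;> simp [hω]
      have h3 : ∫ ω in Z ⁻¹' C, A.indicator (fun ω => (κ (Z ω)).real D) ω ∂μ =
          (∫⁻ ω in Z ⁻¹' C, κ (Z ω) D ∂(μ.restrict A)).toReal := by
        rw [setIntegral_indicator hAm, Measure.restrict_restrict (hZ hC)]
        exact integral_toReal ((κ.measurable_coe hD).comp hZ).aemeasurable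
          (ae_of_all _ fun ω => measure_lt_top _ _)
      rw [h1, h2, h3, ENNReal.toReal_eq_toReal_iff' (measure_ne_top _ _)]
      refine ((lintegral_mono fun ω => prob_le_one).trans_lt (b := ∫⁻ _, 1 ∂_) ?_).ne
      simp
    constructor
    · exact fun h C hCm => (hC C hCm).1 (h _ ⟨C, hCm, rfl⟩)
    · rintro h _ ⟨C, hCm, rfl⟩
      exact (hC C hCm).2 (h C hCm)
  constructor
  · intro h A hA
    rw [map_restrict_eq_compProd_iff hZ hW]
    exact fun C D hC hD => (hset D A hD hA).1 (h _ _ ⟨D, hD, rfl⟩ hA) C hC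
  · rintro h _ A ⟨D, hD, rfl⟩ hA
    exact (hset D A hD hA).2 fun C hC =>
      (map_restrict_eq_compProd_iff (κ := κ) hZ hW A).1 (h A hA) C D hC hD

lemma IsCondKernelGiven.map_eq (h : IsCondKernelGiven m μ Z W κ) :
    μ.map (fun ω => (Z ω, W ω)) = μ.map Z ⊗ₘ κ := by
  simpa using h Set.univ MeasurableSet.univ

end CondKernel

section Cylinders

variable {X Y : Fin (n + 1) → Type*}

/-- The event that the hidden states with index in `A` lie in the sets `S` and the observations
with index in `B` lie in the sets `T`. -/
def cylinder (A B : Set (Fin (n + 1))) (S : ∀ i, Set (X i)) (T : ∀ i, Set (Y i)) :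
    Set (∀ i, X i × Y i) :=
  {ω | (∀ i ∈ A, (ω i).1 ∈ S i) ∧ ∀ j ∈ B, (ω j).2 ∈ T j}

lemma univ_pi_prod_eq_cylinder (S : ∀ i, Set (X i)) (T : ∀ i, Set (Y i)) :
    (Set.univ.pi fun i => S i ×ˢ T i) = cylinder Set.univ Set.univ S T := by
  ext ω
  simp [cylinder, Set.mem_pi, forall_and]

lemma cylinder_Iic_Iio (t : Fin (n + 1)) (S : ∀ i, Set (X i)) (T : ∀ i, Set (Y i)) :
    cylinder (Set.Iic t) (Set.Iio t) S T =
      cylinder (Set.Iio t) (Set.Iio t) S T ∩ (fun ω => (ω t).1) ⁻¹' S t := by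
  ext ω
  simp only [cylinder, Set.mem_ofPred_eq, Set.mem_inter_iff, Set.mem_preimage, Set.mem_Iic,
    Set.mem_Iio, le_iff_lt_or_eq, or_imp, forall_and, forall_eq]
  tauto

lemma cylinder_Iic_Iic (t : Fin (n + 1)) (S : ∀ i, Set (X i)) (T : ∀ i, Set (Y i)) :
    cylinder (Set.Iic t) (Set.Iic t) S T =
      cylinder (Set.Iio t) (Set.Iio t) S T ∩
        ((fun ω => (ω t).1) ⁻¹' S t ∩ (fun ω => (ω t).2) ⁻¹' T t) := by
  ext ω
  simp only [cylinder, Set.mem_ofPred_eq, Set.mem_inter_iff, Set.mem_preimage, Set.mem_Iic,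
    Set.mem_Iio, le_iff_lt_or_eq, or_imp, forall_and, forall_eq]
  tauto

lemma cylinder_Iic_Iic' (t : Fin (n + 1)) (S : ∀ i, Set (X i)) (T : ∀ i, Set (Y i)) :
    cylinder (Set.Iic t) (Set.Iic t) S T =
      cylinder (Set.Iio t) (Set.Iic t) S T ∩ (fun ω => (ω t).1) ⁻¹' S t := by
  ext ω
  simp only [cylinder, Set.mem_ofPred_eq, Set.mem_inter_iff, Set.mem_preimage, Set.mem_Iic,
    Set.mem_Iio, le_iff_lt_or_eq, or_imp, forall_and, forall_eq]
  tauto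

lemma cylinder_Iic_Iio_succ (i : Fin n) (S : ∀ i, Set (X i)) (T : ∀ i, Set (Y i)) :
    cylinder (Set.Iic i.succ) (Set.Iio i.succ) S T =
      cylinder (Set.Iio i.castSucc) (Set.Iic i.castSucc) S T ∩
        ((fun ω => (ω i.castSucc).1) ⁻¹' S i.castSucc ∩
          (fun ω => (ω i.succ).1) ⁻¹' S i.succ) := by
  have hlt : ∀ j, j < i.succ ↔ j ≤ i.castSucc := fun j => Fin.le_castSucc_iff.symm
  ext ω
  simp only [cylinder, Set.mem_ofPred_eq, Set.mem_inter_iff, Set.mem_preimage, Set.mem_Iic,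
    Set.mem_Iio, le_iff_lt_or_eq (b := i.succ), hlt]
  simp only [le_iff_lt_or_eq, or_imp, forall_and, forall_eq]
  tauto

lemma cylinder_congr {A B : Set (Fin (n + 1))} {S S' : ∀ i, Set (X i)} {T T' : ∀ i, Set (Y i)}
    (hS : ∀ i ∈ A, S i = S' i) (hT : ∀ i ∈ B, T i = T' i) :
    cylinder A B S T = cylinder A B S' T' := by
  ext ω
  simp only [cylinder, Set.mem_ofPred_eq]
  exact and_congr (forall₂_congr fun i hi => by rw [hS i hi])
    (forall₂_congr fun i hi => by rw [hT i hi])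

lemma cylinder_eq_of_eq_univ {A A' B B' : Set (Fin (n + 1))} {S : ∀ i, Set (X i)}
    {T : ∀ i, Set (Y i)} (hA : A ⊆ A') (hB : B ⊆ B') (hS : ∀ i ∉ A, S i = Set.univ)
    (hT : ∀ i ∉ B, T i = Set.univ) :
    cylinder A' B' S T = cylinder A B S T := by
  ext ω
  refine ⟨fun h => ⟨fun i hi => h.1 i (hA hi), fun i hi => h.2 i (hB hi)⟩,
    fun h => ⟨fun i _ => ?_, fun i _ => ?_⟩⟩
  · by_cases hi : i ∈ A
    · exact h.1 i hi
    · simp [hS i hi]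
  · by_cases hi : i ∈ B
    · exact h.2 i hi
    · simp [hT i hi]

variable [∀ i, MeasurableSpace (X i)] [∀ i, MeasurableSpace (Y i)]

/-- The cylinders over measurable sets. -/
def measurableCylinders (X Y : Fin (n + 1) → Type*) [∀ i, MeasurableSpace (X i)]
    [∀ i, MeasurableSpace (Y i)] (A B : Set (Fin (n + 1))) : Set (Set (∀ i, X i × Y i)) :=
  {E | ∃ (S : ∀ i, Set (X i)) (T : ∀ i, Set (Y i)),
    (∀ i, MeasurableSet (S i)) ∧ (∀ i, MeasurableSet (T i)) ∧ E = cylinder A B S T}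

lemma isPiSystem_measurableCylinders (A B : Set (Fin (n + 1))) :
    IsPiSystem (measurableCylinders X Y A B) := by
  rintro _ ⟨S, T, hS, hT, rfl⟩ _ ⟨S', T', hS', hT', rfl⟩ -
  refine ⟨fun i => S i ∩ S' i, fun i => T i ∩ T' i, fun i => (hS i).inter (hS' i),
    fun i => (hT i).inter (hT' i), ?_⟩
  ext ω
  simp only [cylinder, Set.mem_ofPred_eq, Set.mem_inter_iff, forall_and]
  tauto

lemma univ_mem_measurableCylinders (A B : Set (Fin (n + 1))) :
    Set.univ ∈ measurableCylinders X Y A B :=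
  ⟨fun _ => Set.univ, fun _ => Set.univ, fun _ => .univ, fun _ => .univ, by simp [cylinder]⟩

lemma measurableSet_cylinder {A B : Set (Fin (n + 1))} {S : ∀ i, Set (X i)} {T : ∀ i, Set (Y i)}
    (hS : ∀ i, MeasurableSet (S i)) (hT : ∀ i, MeasurableSet (T i)) :
    MeasurableSet[coordSigma A B] (cylinder A B S T) := by
  have hcyl : cylinder A B S T = (⋂ i ∈ A, (fun ω : ∀ i, X i × Y i => (ω i).1) ⁻¹' S i) ∩
      ⋂ j ∈ B, (fun ω : ∀ i, X i × Y i => (ω j).2) ⁻¹' T j := by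
    ext ω
    simp [cylinder]
  rw [hcyl]
  refine MeasurableSet.inter (.biInter A.to_countable fun i hi => ?_)
    (.biInter B.to_countable fun j hj => ?_)
  · refine (le_sup_left : _ ≤ coordSigma (X := X) (Y := Y) A B) _ ?_
    exact le_iSup₂ (f := fun i (_ : i ∈ A) => MeasurableSpace.comap
      (fun ω : ∀ i, X i × Y i => (ω i).1) inferInstance) i hi _ ⟨S i, hS i, rfl⟩
  · refine (le_sup_right : _ ≤ coordSigma (X := X) (Y := Y) A B) _ ?_
    exact le_iSup₂ (f := fun j (_ : j ∈ B) => MeasurableSpace.comap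
      (fun ω : ∀ i, X i × Y i => (ω j).2) inferInstance) j hj _ ⟨T j, hT j, rfl⟩

lemma coordSigma_eq_generateFrom (A B : Set (Fin (n + 1))) :
    coordSigma (X := X) (Y := Y) A B =
      MeasurableSpace.generateFrom (measurableCylinders X Y A B) := by
  classical
  refine le_antisymm (sup_le (iSup₂_le fun i hi => ?_) (iSup₂_le fun j hj => ?_))
    (MeasurableSpace.generateFrom_le ?_)
  · rintro _ ⟨s, hs, rfl⟩
    refine MeasurableSpace.measurableSet_generateFrom
      ⟨Function.update (fun _ => Set.univ) i s, fun _ => Set.univ, fun k => ?_, fun _ => .univ, ?_⟩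
    · rcases eq_or_ne k i with rfl | hk <;> simp [*]
    · ext ω
      simp only [cylinder, Set.mem_preimage, Set.mem_ofPred_eq, Set.mem_univ, implies_true, and_true]
      refine ⟨fun h k _ => ?_, fun h => by simpa using h i hi⟩
      rcases eq_or_ne k i with rfl | hk <;> simp [*]
  · rintro _ ⟨s, hs, rfl⟩
    refine MeasurableSpace.measurableSet_generateFrom
      ⟨fun _ => Set.univ, Function.update (fun _ => Set.univ) j s, fun _ => .univ, fun k => ?_, ?_⟩
    · rcases eq_or_ne k j with rfl | hk <;> simp [*]
    · ext ω
      simp only [cylinder, Set.mem_preimage, Set.mem_ofPred_eq, Set.mem_univ, implies_true, true_and]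
      refine ⟨fun h k _ => ?_, fun h => by simpa using h j hj⟩
      rcases eq_or_ne k j with rfl | hk <;> simp [*]
  · rintro _ ⟨S, T, hS, hT, rfl⟩
    exact measurableSet_cylinder hS hT

@[fun_prop]
lemma measurable_state (t : Fin (n + 1)) :
    Measurable fun ω : ∀ i, X i × Y i => (ω t).1 :=
  (measurable_pi_apply t).fst

@[fun_prop]
lemma measurable_obs (t : Fin (n + 1)) :
    Measurable fun ω : ∀ i, X i × Y i => (ω t).2 :=
  (measurable_pi_apply t).snd

lemma coordSigma_singleton_empty (t : Fin (n + 1)) :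
    coordSigma (X := X) (Y := Y) {t} ∅ = MeasurableSpace.comap (fun ω => (ω t).1) inferInstance := by
  simp [coordSigma]

lemma coordSigma_empty_singleton (t : Fin (n + 1)) :
    coordSigma (X := X) (Y := Y) ∅ {t} = MeasurableSpace.comap (fun ω => (ω t).2) inferInstance := by
  simp [coordSigma]

end Cylinders

section HiddenMarkov

variable {X Y : Fin (n + 1) → Type*} [∀ i, MeasurableSpace (X i)] [∀ i, MeasurableSpace (Y i)]
  {f : ∀ t : Fin n, Kernel (X t.castSucc) (X t.succ)} {g : ∀ t : Fin (n + 1), Kernel (X t) (Y t)}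
  {S : ∀ i, Set (X i)} {T : ∀ i, Set (Y i)} {q : Measure (∀ i, X i × Y i)}

lemma hmmBack_last (x : X (Fin.last n)) :
    hmmBack f g S T (Fin.last n) x = g (Fin.last n) x (T (Fin.last n)) := by
  simp [hmmBack]

lemma hmmBack_castSucc (i : Fin n) (x : X i.castSucc) :
    hmmBack f g S T i.castSucc x =
      g i.castSucc x (T i.castSucc) * ∫⁻ x' in S i.succ, hmmBack f g S T i.succ x' ∂(f i x) := by
  simp [hmmBack]

lemma measurable_hmmBack [∀ t, IsMarkovKernel (f t)] (hS : ∀ i, MeasurableSet (S i))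
    (hT : ∀ i, MeasurableSet (T i)) (t : Fin (n + 1)) : Measurable (hmmBack f g S T t) := by
  induction t using Fin.reverseInduction with
  | last =>
    simp_rw [funext hmmBack_last]
    exact (g _).measurable_coe (hT _)
  | cast i ih =>
    simp_rw [funext (hmmBack_castSucc i)]
    exact ((g _).measurable_coe (hT _)).mul (ih.setLIntegral_kernel (hS _))

lemma hmmBack_of_eq_univ [∀ t, IsMarkovKernel (f t)] [∀ t, IsMarkovKernel (g t)]
    (t : Fin (n + 1)) (hS : ∀ i, t < i → S i = Set.univ) (hT : ∀ i, t < i → T i = Set.univ)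
    (x : X t) : hmmBack f g S T t x = g t x (T t) := by
  induction t using Fin.reverseInduction with
  | last => exact hmmBack_last x
  | cast i ih =>
    have hi := i.castSucc_lt_succ
    have ih' := ih (fun j hj => hS j (hi.trans hj)) (fun j hj => hT j (hi.trans hj))
    rw [hmmBack_castSucc, hS _ hi]
    simp [ih', hT _ hi]

lemma setLIntegral_cylinder_obs [IsFiniteMeasure q] {t : Fin (n + 1)} [IsMarkovKernel (g t)]
    (h : IsCondKernelGiven (coordSigma (Set.Iio t) (Set.Iio t)) q (fun ω => (ω t).1)
      (fun ω => (ω t).2) (g t))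
    (hS : ∀ i, MeasurableSet (S i)) (hT : ∀ i, MeasurableSet (T i))
    {H : X t → ℝ≥0∞} (hH : Measurable H) :
    ∫⁻ ω in cylinder (Set.Iic t) (Set.Iic t) S T, H (ω t).1 ∂q =
      ∫⁻ ω in cylinder (Set.Iic t) (Set.Iio t) S T, g t (ω t).1 (T t) * H (ω t).1 ∂q := by
  rw [cylinder_Iic_Iic, cylinder_Iic_Iio]
  refine (h.setLIntegral_eq (by fun_prop) (by fun_prop) (measurableSet_cylinder hS hT) (hS t)
    (hT t) (φ := fun p => H p.1) (by fun_prop)).trans ?_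
  simp [mul_comm]

lemma setLIntegral_cylinder_state [IsFiniteMeasure q] {i : Fin n} [IsMarkovKernel (f i)]
    (h : IsCondKernelGiven (coordSigma (Set.Iio i.castSucc) (Set.Iic i.castSucc)) q
      (fun ω => (ω i.castSucc).1) (fun ω => (ω i.succ).1) (f i))
    (hS : ∀ i, MeasurableSet (S i)) (hT : ∀ i, MeasurableSet (T i))
    {H : X i.succ → ℝ≥0∞} (hH : Measurable H) :
    ∫⁻ ω in cylinder (Set.Iic i.succ) (Set.Iio i.succ) S T, H (ω i.succ).1 ∂q =
      ∫⁻ ω in cylinder (Set.Iic i.castSucc) (Set.Iic i.castSucc) S T,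
        ∫⁻ x in S i.succ, H x ∂(f i (ω i.castSucc).1) ∂q := by
  rw [cylinder_Iic_Iio_succ, cylinder_Iic_Iic']
  exact h.setLIntegral_eq (by fun_prop) (by fun_prop) (measurableSet_cylinder hS hT) (hS _)
    (hS _) (φ := fun p => H p.2) (by fun_prop)

/-- The mass of a product set when the factors up to time `t` are integrated against `q` and the
later ones against the kernels. -/
noncomputable def hybridMass (q : Measure (∀ i, X i × Y i))
    (f : ∀ t : Fin n, Kernel (X t.castSucc) (X t.succ)) (g : ∀ t : Fin (n + 1), Kernel (X t) (Y t))
    (S : ∀ i, Set (X i)) (T : ∀ i, Set (Y i)) (t : Fin (n + 1)) : ℝ≥0∞ :=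
  ∫⁻ ω in cylinder (Set.Iic t) (Set.Iio t) S T, hmmBack f g S T t (ω t).1 ∂q

lemma hybridMass_zero [∀ t, IsMarkovKernel (f t)] (hS : ∀ i, MeasurableSet (S i))
    (hT : ∀ i, MeasurableSet (T i)) :
    hybridMass q f g S T 0 =
      ∫⁻ x in S 0, hmmBack f g S T 0 x ∂(q.map fun ω => (ω 0).1) := by
  rw [setLIntegral_map (hS 0) (measurable_hmmBack hS hT 0) (by fun_prop), hybridMass]
  congr 2
  ext ω
  simp [cylinder]

lemma hybridMass_last [IsFiniteMeasure q] [∀ t, IsMarkovKernel (g t)]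
    (h : IsCondKernelGiven (coordSigma (Set.Iio (Fin.last n)) (Set.Iio (Fin.last n))) q
      (fun ω => (ω (Fin.last n)).1) (fun ω => (ω (Fin.last n)).2) (g (Fin.last n)))
    (hS : ∀ i, MeasurableSet (S i)) (hT : ∀ i, MeasurableSet (T i)) :
    hybridMass q f g S T (Fin.last n) = q (Set.univ.pi fun i => S i ×ˢ T i) := by
  have := setLIntegral_cylinder_obs h hS hT (H := fun _ => 1) measurable_const
  simp only [hybridMass, hmmBack_last]
  simp only [mul_one] at this
  rw [← this, univ_pi_prod_eq_cylinder, setLIntegral_one]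
  congr 2 <;> ext i <;> simp [Fin.le_last]

lemma hybridMass_castSucc [IsFiniteMeasure q] [∀ t, IsMarkovKernel (f t)]
    [∀ t, IsMarkovKernel (g t)] {i : Fin n}
    (h : IsCondKernelGiven (coordSigma (Set.Iio i.castSucc) (Set.Iio i.castSucc)) q
      (fun ω => (ω i.castSucc).1) (fun ω => (ω i.castSucc).2) (g i.castSucc))
    (hS : ∀ i, MeasurableSet (S i)) (hT : ∀ i, MeasurableSet (T i)) :
    hybridMass q f g S T i.castSucc =
      ∫⁻ ω in cylinder (Set.Iic i.castSucc) (Set.Iic i.castSucc) S T,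
        ∫⁻ x in S i.succ, hmmBack f g S T i.succ x ∂(f i (ω i.castSucc).1) ∂q := by
  simp only [hybridMass, hmmBack_castSucc]
  exact (setLIntegral_cylinder_obs h hS hT
    ((measurable_hmmBack hS hT i.succ).setLIntegral_kernel (hS _))).symm

lemma hybridMass_castSucc_eq_succ [IsFiniteMeasure q] [∀ t, IsMarkovKernel (f t)]
    [∀ t, IsMarkovKernel (g t)] {i : Fin n}
    (hg : IsCondKernelGiven (coordSigma (Set.Iio i.castSucc) (Set.Iio i.castSucc)) q
      (fun ω => (ω i.castSucc).1) (fun ω => (ω i.castSucc).2) (g i.castSucc))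
    (hf : IsCondKernelGiven (coordSigma (Set.Iio i.castSucc) (Set.Iic i.castSucc)) q
      (fun ω => (ω i.castSucc).1) (fun ω => (ω i.succ).1) (f i))
    (hS : ∀ i, MeasurableSet (S i)) (hT : ∀ i, MeasurableSet (T i)) :
    hybridMass q f g S T i.castSucc = hybridMass q f g S T i.succ := by
  rw [hybridMass_castSucc hg hS hT, hybridMass,
    setLIntegral_cylinder_state hf hS hT (measurable_hmmBack hS hT _)]

/-- The sets `S i` before time `t`, the set `C` at time `t`, and no constraint afterwards. -/
def truncateAt {V : Fin (n + 1) → Type*} (t : Fin (n + 1)) (S : ∀ i, Set (V i)) (C : Set (V t)) :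
    ∀ i, Set (V i) :=
  Function.update (fun i => if i < t then S i else Set.univ) t C

section truncateAt

variable {V : Fin (n + 1) → Type*} {t : Fin (n + 1)} {U : ∀ i, Set (V i)} {C : Set (V t)}

@[simp]
lemma truncateAt_self : truncateAt t U C t = C := by simp [truncateAt]

lemma truncateAt_of_lt {i : Fin (n + 1)} (h : i < t) : truncateAt t U C i = U i := by
  simp [truncateAt, h.ne, h]

lemma truncateAt_of_gt {i : Fin (n + 1)} (h : t < i) : truncateAt t U C i = Set.univ := by
  simp [truncateAt, h.ne', h.not_gt]

lemma measurableSet_truncateAt [∀ i, MeasurableSpace (V i)] (hU : ∀ i, MeasurableSet (U i))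
    (hC : MeasurableSet C) (i : Fin (n + 1)) : MeasurableSet (truncateAt t U C i) := by
  rcases lt_trichotomy i t with h | rfl | h
  · rw [truncateAt_of_lt h]; exact hU i
  · simpa using hC
  · rw [truncateAt_of_gt h]; exact .univ

end truncateAt

lemma isCondKernelGiven_obs [IsFiniteMeasure q] [∀ t, IsMarkovKernel (f t)]
    [∀ t, IsMarkovKernel (g t)] {t : Fin (n + 1)}
    (h : ∀ (S : ∀ i, Set (X i)) (T : ∀ i, Set (Y i)), (∀ i, MeasurableSet (S i)) →
      (∀ i, MeasurableSet (T i)) →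
        hybridMass q f g S T t = q (Set.univ.pi fun i => S i ×ˢ T i)) :
    IsCondKernelGiven (coordSigma (Set.Iio t) (Set.Iio t)) q (fun ω => (ω t).1)
      (fun ω => (ω t).2) (g t) := by
  refine isCondKernelGiven_of_generateFrom (by fun_prop) (by fun_prop) (coordSigma_le _ _)
    (coordSigma_eq_generateFrom _ _) (isPiSystem_measurableCylinders _ _)
    (univ_mem_measurableCylinders _ _) ?_
  rintro _ ⟨S, T, hS, hT, rfl⟩ C D hC hD
  have key := h (truncateAt t S C) (truncateAt t T D) (measurableSet_truncateAt hS hC)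
    (measurableSet_truncateAt hT hD)
  have hgt : ∀ i ∉ Set.Iic t, t < i := fun i hi => not_le.1 hi
  have hcyl : cylinder (Set.Iio t) (Set.Iio t) (truncateAt t S C) (truncateAt t T D) =
      cylinder (Set.Iio t) (Set.Iio t) S T :=
    cylinder_congr (fun i hi => truncateAt_of_lt hi) (fun i hi => truncateAt_of_lt hi)
  rw [univ_pi_prod_eq_cylinder, cylinder_eq_of_eq_univ (Set.subset_univ (Set.Iic t))
    (Set.subset_univ (Set.Iic t)) (fun i hi => truncateAt_of_gt (hgt i hi))
    (fun i hi => truncateAt_of_gt (hgt i hi)), cylinder_Iic_Iic, hcyl, truncateAt_self,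
    truncateAt_self, hybridMass, cylinder_Iic_Iio, hcyl, truncateAt_self] at key
  simp only [hmmBack_of_eq_univ t (fun i hi => truncateAt_of_gt hi)
    (fun i hi => truncateAt_of_gt hi), truncateAt_self] at key
  exact key.symm

lemma isCondKernelGiven_state [IsFiniteMeasure q] [∀ t, IsMarkovKernel (f t)]
    [∀ t, IsMarkovKernel (g t)] {i : Fin n}
    (hg : IsCondKernelGiven (coordSigma (Set.Iio i.castSucc) (Set.Iio i.castSucc)) q
      (fun ω => (ω i.castSucc).1) (fun ω => (ω i.castSucc).2) (g i.castSucc))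
    (h : ∀ (S : ∀ i, Set (X i)) (T : ∀ i, Set (Y i)), (∀ i, MeasurableSet (S i)) →
      (∀ i, MeasurableSet (T i)) →
        hybridMass q f g S T i.castSucc = q (Set.univ.pi fun i => S i ×ˢ T i)) :
    IsCondKernelGiven (coordSigma (Set.Iio i.castSucc) (Set.Iic i.castSucc)) q
      (fun ω => (ω i.castSucc).1) (fun ω => (ω i.succ).1) (f i) := by
  refine isCondKernelGiven_of_generateFrom (by fun_prop) (by fun_prop) (coordSigma_le _ _)
    (coordSigma_eq_generateFrom _ _) (isPiSystem_measurableCylinders _ _)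
    (univ_mem_measurableCylinders _ _) ?_
  rintro _ ⟨S, T, hS, hT, rfl⟩ C D hC hD
  have hi := i.castSucc_lt_succ
  obtain ⟨S', hS'_def⟩ : ∃ S', S' = truncateAt i.succ (truncateAt i.castSucc S C) D := ⟨_, rfl⟩
  obtain ⟨T', hT'_def⟩ : ∃ T', T' = truncateAt i.succ T Set.univ := ⟨_, rfl⟩
  have hS' : ∀ j, MeasurableSet (S' j) :=
    hS'_def ▸ measurableSet_truncateAt (measurableSet_truncateAt hS hC) hD
  have hT' : ∀ j, MeasurableSet (T' j) := hT'_def ▸ measurableSet_truncateAt hT .univ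
  have hSsucc : S' i.succ = D := by simp [hS'_def]
  have hScast : S' i.castSucc = C := by rw [hS'_def, truncateAt_of_lt hi, truncateAt_self]
  have hTsucc : T' i.succ = Set.univ := by simp [hT'_def]
  have hSgt : ∀ j, i.succ < j → S' j = Set.univ := fun j hj => by
    rw [hS'_def, truncateAt_of_gt hj]
  have hTgt : ∀ j, i.succ < j → T' j = Set.univ := fun j hj => by
    rw [hT'_def, truncateAt_of_gt hj]
  have hcyl : cylinder (Set.Iio i.castSucc) (Set.Iic i.castSucc) S' T' =
      cylinder (Set.Iio i.castSucc) (Set.Iic i.castSucc) S T := by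
    refine cylinder_congr (fun j hj => ?_) (fun j hj => ?_)
    · rw [hS'_def, truncateAt_of_lt (lt_trans hj hi), truncateAt_of_lt hj]
    · rw [hT'_def, truncateAt_of_lt (lt_of_le_of_lt hj hi)]
  have key := h S' T' hS' hT'
  rw [hybridMass_castSucc hg hS' hT', univ_pi_prod_eq_cylinder,
    cylinder_eq_of_eq_univ (Set.subset_univ (Set.Iic i.succ)) (Set.subset_univ (Set.Iio i.succ))
      (fun j hj => hSgt j (not_le.1 hj)) (fun j hj => ?_), cylinder_Iic_Iio_succ,
    cylinder_Iic_Iic', hcyl, hSsucc, hScast] at key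
  · simp only [hmmBack_of_eq_univ i.succ hSgt hTgt, hTsucc, measure_univ, setLIntegral_one] at key
    exact key.symm
  · rcases (show i.succ ≤ j from not_lt.1 fun h => hj h).eq_or_lt with rfl | hj'
    · exact hTsucc
    · exact hTgt j hj'

lemma IsHMM.initial_eq [∀ t, IsMarkovKernel (f t)] [∀ t, IsMarkovKernel (g t)]
    {f₀ : Measure (X 0)} (h : IsHMM q f₀ f g) : f₀ = q.map fun ω => (ω 0).1 := by
  ext C hC
  have key := h (truncateAt 0 (fun _ => Set.univ) C) (fun _ => Set.univ)
    (measurableSet_truncateAt (fun _ => .univ) hC) (fun _ => .univ)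
  simp only [hmmBack_of_eq_univ (S := truncateAt 0 (fun _ => Set.univ) C)
    (T := fun _ => Set.univ) 0 (fun i hi => truncateAt_of_gt hi) (fun _ _ => rfl),
    measure_univ, setLIntegral_one, truncateAt_self] at key
  rw [Measure.map_apply (by fun_prop) hC, ← key, univ_pi_prod_eq_cylinder,
    cylinder_eq_of_eq_univ (Set.subset_univ {0}) (Set.empty_subset _)
      (fun i hi => truncateAt_of_gt (Fin.pos_of_ne_zero hi)) (fun _ _ => rfl)]
  simp [cylinder, Set.preimage]

lemma IsHMM.isCondKernelGiven [IsFiniteMeasure q] [∀ t, IsMarkovKernel (f t)]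
    [∀ t, IsMarkovKernel (g t)] {f₀ : Measure (X 0)} (h : IsHMM q f₀ f g) :
    (∀ i : Fin n, IsCondKernelGiven (coordSigma (Set.Iio i.castSucc) (Set.Iic i.castSucc)) q
      (fun ω => (ω i.castSucc).1) (fun ω => (ω i.succ).1) (f i)) ∧
    ∀ t : Fin (n + 1), IsCondKernelGiven (coordSigma (Set.Iio t) (Set.Iio t)) q
      (fun ω => (ω t).1) (fun ω => (ω t).2) (g t) := by
  have hmass : ∀ (t : Fin (n + 1)) (S : ∀ i, Set (X i)) (T : ∀ i, Set (Y i)),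
      (∀ i, MeasurableSet (S i)) → (∀ i, MeasurableSet (T i)) →
        hybridMass q f g S T t = q (Set.univ.pi fun i => S i ×ˢ T i) := by
    intro t
    induction t using Fin.induction with
    | zero =>
      intro S T hS hT
      rw [hybridMass_zero hS hT, h S T hS hT, h.initial_eq]
    | succ i ih =>
      intro S T hS hT
      have hg := isCondKernelGiven_obs ih
      rw [← hybridMass_castSucc_eq_succ hg (isCondKernelGiven_state hg ih) hS hT, ih S T hS hT]
  exact ⟨fun i => isCondKernelGiven_state (isCondKernelGiven_obs (hmass _)) (hmass _),
    fun t => isCondKernelGiven_obs (hmass t)⟩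

lemma isHMM_of_isCondKernelGiven [IsFiniteMeasure q] [∀ t, IsMarkovKernel (f t)]
    [∀ t, IsMarkovKernel (g t)]
    (hf : ∀ i : Fin n, IsCondKernelGiven (coordSigma (Set.Iio i.castSucc) (Set.Iic i.castSucc)) q
      (fun ω => (ω i.castSucc).1) (fun ω => (ω i.succ).1) (f i))
    (hg : ∀ t : Fin (n + 1), IsCondKernelGiven (coordSigma (Set.Iio t) (Set.Iio t)) q
      (fun ω => (ω t).1) (fun ω => (ω t).2) (g t)) :
    IsHMM q (q.map fun ω => (ω 0).1) f g := by
  intro S T hS hT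
  have hmass : ∀ t, hybridMass q f g S T t = hybridMass q f g S T 0 := by
    intro t
    induction t using Fin.induction with
    | zero => rfl
    | succ i ih => rw [← hybridMass_castSucc_eq_succ (hg _) (hf i) hS hT, ih]
  rw [← hybridMass_zero hS hT, ← hmass (Fin.last n), hybridMass_last (hg _) hS hT]

section CondIndepCoords

variable [∀ i, StandardBorelSpace (X i)] [∀ i, StandardBorelSpace (Y i)] [IsFiniteMeasure q]

lemma condIndepCoords_state_iff {s t : Fin (n + 1)} [Nonempty (X t)] {B B' : Set (Fin (n + 1))}
    {κ : Kernel (X s) (X t)} [IsMarkovKernel κ]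
    (hκ : q.map (fun ω => ((ω s).1, (ω t).1)) = (q.map fun ω => (ω s).1) ⊗ₘ κ) :
    CondIndepCoords q {s} ∅ {t} ∅ B B' ↔
      IsCondKernelGiven (coordSigma B B') q (fun ω => (ω s).1) (fun ω => (ω t).1) κ := by
  rw [← condIndep_comap_iff_isCondKernelGiven (by fun_prop) (by fun_prop) (coordSigma_le _ _) hκ]
  simp only [CondIndepCoords, coordSigma_singleton_empty]

lemma condIndepCoords_obs_iff {t : Fin (n + 1)} [Nonempty (Y t)] {B B' : Set (Fin (n + 1))}
    {κ : Kernel (X t) (Y t)} [IsMarkovKernel κ]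
    (hκ : q.map (fun ω => ((ω t).1, (ω t).2)) = (q.map fun ω => (ω t).1) ⊗ₘ κ) :
    CondIndepCoords q {t} ∅ ∅ {t} B B' ↔
      IsCondKernelGiven (coordSigma B B') q (fun ω => (ω t).1) (fun ω => (ω t).2) κ := by
  rw [← condIndep_comap_iff_isCondKernelGiven (by fun_prop) (by fun_prop) (coordSigma_le _ _) hκ]
  simp only [CondIndepCoords, coordSigma_singleton_empty, coordSigma_empty_singleton]

lemma forall_nat_condIndepCoords_state_iff :
    (∀ (t : ℕ) (_ : 1 ≤ t) (hpred : t - 1 < n + 1) (ht : t < n + 1),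
        CondIndepCoords q {(⟨t - 1, hpred⟩ : Fin (n + 1))} ∅ {(⟨t, ht⟩ : Fin (n + 1))} ∅
          {i : Fin (n + 1) | (i : ℕ) + 2 ≤ t} {j : Fin (n + 1) | (j : ℕ) < t}) ↔
      ∀ i : Fin n, CondIndepCoords q {i.castSucc} ∅ {i.succ} ∅
        (Set.Iio i.castSucc) (Set.Iic i.castSucc) := by
  have hlt : ∀ i : Fin n, {j : Fin (n + 1) | (j : ℕ) + 2 ≤ i + 1} = Set.Iio i.castSucc := by
    intro i; ext j; simp only [Set.mem_ofPred_eq, Set.mem_Iio, Fin.lt_def, Fin.val_castSucc]; omega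
  have hle : ∀ i : Fin n, {j : Fin (n + 1) | (j : ℕ) < i + 1} = Set.Iic i.castSucc := by
    intro i; ext j; simp only [Set.mem_ofPred_eq, Set.mem_Iic, Fin.le_def, Fin.val_castSucc]; omega
  refine ⟨fun h i => ?_, fun h t ht1 hpred ht => ?_⟩
  · have := h (i + 1) (Nat.le_add_left _ _) i.castSucc.isLt i.succ.isLt
    rwa [hlt, hle] at this
  · obtain ⟨k, rfl⟩ := Nat.exists_eq_add_of_le' ht1
    have := h ⟨k, Nat.lt_of_succ_lt_succ ht⟩
    rwa [← hlt, ← hle] at this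

lemma forall_nat_condIndepCoords_obs_iff :
    (∀ (t : ℕ) (_ : 1 ≤ t) (ht : t < n + 1),
        CondIndepCoords q {(⟨t, ht⟩ : Fin (n + 1))} ∅ ∅ {(⟨t, ht⟩ : Fin (n + 1))}
          {i : Fin (n + 1) | (i : ℕ) < t} {j : Fin (n + 1) | (j : ℕ) < t}) ↔
      ∀ t : Fin (n + 1), CondIndepCoords q {t} ∅ ∅ {t} (Set.Iio t) (Set.Iio t) := by
  refine ⟨fun h t => ?_, fun h t _ ht => h ⟨t, ht⟩⟩
  rcases Nat.eq_zero_or_pos (t : ℕ) with h0 | h0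
  · obtain rfl : t = 0 := Fin.ext h0
    have hempty : Set.Iio (0 : Fin (n + 1)) = ∅ := by ext j; simp
    have hbot : coordSigma (X := X) (Y := Y) ∅ ∅ = ⊥ := by simp [coordSigma]
    rw [CondIndepCoords, hempty, hbot]
    exact condIndep_bot_right _
  · exact h t h0 t.isLt

end CondIndepCoords

end HiddenMarkov

/-- **The backward Markov property characterizes hidden Markov models**
(Proposition `MarkovProperties`, (i) ⇔ (iv), instantiated in `BorelStoch`). -/
theorem backwardMarkov_iff_isHMM
    {X Y : Fin (n+1) → Type*} [∀ i, MeasurableSpace (X i)] [∀ i, MeasurableSpace (Y i)]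
    [∀ i, StandardBorelSpace (X i)] [∀ i, StandardBorelSpace (Y i)]
    (q : Measure (∀ i, X i × Y i)) [IsProbabilityMeasure q] :
    ((∀ (t : ℕ) (ht1 : 1 ≤ t) (ht2 : t ≤ n),
        CondIndepCoords q
          {(⟨t - 1, by omega⟩ : Fin (n+1))} ∅
          {(⟨t, by omega⟩ : Fin (n+1))} ∅
          {i : Fin (n+1) | (i : ℕ) + 2 ≤ t} {j : Fin (n+1) | (j : ℕ) < t}) ∧
      (∀ (t : ℕ) (ht1 : 1 ≤ t) (ht2 : t ≤ n),
        CondIndepCoords q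
          {(⟨t, by omega⟩ : Fin (n+1))} ∅
          ∅ {(⟨t, by omega⟩ : Fin (n+1))}
          {i : Fin (n+1) | (i : ℕ) < t} {j : Fin (n+1) | (j : ℕ) < t}))
    ↔ (∃ (f₀ : Measure (X 0)) (f : ∀ t : Fin n, Kernel (X t.castSucc) (X t.succ))
          (g : ∀ t : Fin (n+1), Kernel (X t) (Y t)),
        IsProbabilityMeasure f₀ ∧ (∀ t, IsMarkovKernel (f t)) ∧
          (∀ t, IsMarkovKernel (g t)) ∧ IsHMM q f₀ f g) := by
  refine (and_congr
    (Iff.trans ⟨fun h t ht1 _ ht => h t ht1 (Nat.le_of_lt_succ ht), fun h t ht1 ht2 => h t ht1 _ _⟩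
      forall_nat_condIndepCoords_state_iff)
    (Iff.trans ⟨fun h t ht1 ht => h t ht1 (Nat.le_of_lt_succ ht), fun h t ht1 ht2 => h t ht1 _⟩
      forall_nat_condIndepCoords_obs_iff)).trans ?_
  obtain ⟨ω₀⟩ : Nonempty (∀ i, X i × Y i) := nonempty_of_isProbabilityMeasure q
  have hX : ∀ i, Nonempty (X i) := fun i => ⟨(ω₀ i).1⟩
  have hY : ∀ i, Nonempty (Y i) := fun i => ⟨(ω₀ i).2⟩
  constructor
  · rintro ⟨hstate, hobs⟩
    refine ⟨q.map fun ω => (ω 0).1,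
      fun i => condDistrib (fun ω => (ω i.succ).1) (fun ω => (ω i.castSucc).1) q,
      fun t => condDistrib (fun ω => (ω t).2) (fun ω => (ω t).1) q,
      Measure.isProbabilityMeasure_map (measurable_state 0).aemeasurable, fun _ => inferInstance,
      fun _ => inferInstance, isHMM_of_isCondKernelGiven (fun i => ?_) (fun t => ?_)⟩
    · exact (condIndepCoords_state_iff
        (compProd_map_condDistrib (measurable_state _).aemeasurable).symm).1 (hstate i)
    · exact (condIndepCoords_obs_iff
        (compProd_map_condDistrib (measurable_obs _).aemeasurable).symm).1 (hobs t)
  · rintro ⟨f₀, f, g, -, hf, hg, h⟩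
    obtain ⟨hstate, hobs⟩ := h.isCondKernelGiven
    exact ⟨fun i => (condIndepCoords_state_iff (hstate i).map_eq).2 (hstate i),
      fun t => (condIndepCoords_obs_iff (hobs t).map_eq).2 (hobs t)⟩

end HMMStmt
end
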